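/- If the environment is uniformly elliptic, i.e. inf_{k∈ℤ} ω_k > 0, then there exists a constant D > 0 such that (P^n)_{i,j} ≤ D·n^{−1/2} for all (i,j) ∈ ℤ² and all n ≥ 1. In particular, sup_{n≥0} sup_{k∈ℤ} √n · (P^n)_{0,k} < ∞. -/

import Mathlib

open Filter MeasureTheory Topology

/-- `(P^n)_{k,j}` for the balanced walk on `ℤ` with transition probabilities
`P_{k,k-1} = P_{k,k+1} = ω k`, `P_{k,k} = 1 - 2 ω k`. -/
noncomputable def Ppow (ω : ℤ → ℝ) : ℕ → ℤ → ℤ → ℝ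
  | 0, k, j => if k = j then 1 else 0
  | n + 1, k, j =>
      ω k * Ppow ω n (k - 1) j + (1 - 2 * ω k) * Ppow ω n k j + ω k * Ppow ω n (k + 1) j

/-- One step of the balanced walk, acting on functions. -/
noncomputable def balancedStep (ω f : ℤ → ℝ) (k : ℤ) : ℝ :=
  ω k * f (k - 1) + (1 - 2 * ω k) * f k + ω k * f (k + 1)

/-- The squared norm of `f` in `ℓ²` of the reversible measure `1 / ω`. -/
noncomputable def reversibleEnergy (ω f : ℤ → ℝ) : ℝ := ∑' k, f k ^ 2 / ω k

lemma summable_int_of_finite_support {f g : ℤ → ℝ} (hf : f.support.Finite)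
    (h : ∀ k, f k = 0 → g k = 0) : Summable g :=
  summable_of_hasFiniteSupport (hf.subset fun k hk hk' => hk (h k hk'))

lemma finite_support_shift {f : ℤ → ℝ} (hf : f.support.Finite) (a : ℤ) :
    (fun k => f (k + a)).support.Finite :=
  hf.preimage (f := fun k => k + a) (add_left_injective a).injOn

lemma tsum_int_shift (f : ℤ → ℝ) (a : ℤ) : ∑' k, f (k + a) = ∑' k, f k :=
  (Equiv.addRight a).tsum_eq f

lemma finite_support_balancedStep {ω f : ℤ → ℝ} (hf : f.support.Finite) :
    (balancedStep ω f).support.Finite := by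
  refine ((hf.union (finite_support_shift hf 1)).union (finite_support_shift hf (-1))).subset ?_
  intro k hk
  by_contra h
  simp only [Set.mem_union, Function.mem_support, not_or, not_not, ← sub_eq_add_neg] at h
  exact hk (by simp [balancedStep, h.1.1, h.1.2, h.2])

lemma balancedStep_nonneg {ω f : ℤ → ℝ} (hω : ∀ k, 0 < ω k ∧ ω k ≤ 1 / 2) (hf : ∀ k, 0 ≤ f k)
    (k : ℤ) : 0 ≤ balancedStep ω f k := by
  have h₁ := mul_nonneg (hω k).1.le (hf (k - 1))
  have h₂ := mul_nonneg (show 0 ≤ 1 - 2 * ω k by linarith [(hω k).2]) (hf k)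
  have h₃ := mul_nonneg (hω k).1.le (hf (k + 1))
  unfold balancedStep
  linarith

/-- Maximum principle. -/
lemma exists_le_of_le_balancedStep {ω f : ℤ → ℝ} (hω : ∀ k, 0 < ω k ∧ ω k ≤ 1 / 2) {x : ℝ}
    {i : ℤ} (h : x ≤ balancedStep ω f i) : ∃ k, x ≤ f k := by
  by_contra! hlt
  have h₁ := mul_pos (hω i).1 (sub_pos.2 (hlt (i - 1)))
  have h₂ := mul_nonneg (show 0 ≤ 1 - 2 * ω i by linarith [(hω i).2]) (sub_pos.2 (hlt i)).le
  have h₃ := mul_pos (hω i).1 (sub_pos.2 (hlt (i + 1)))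
  unfold balancedStep at h
  linarith

/-- The measure `1 / ω` is invariant. -/
lemma tsum_balancedStep_div {ω f : ℤ → ℝ} (hω : ∀ k, 0 < ω k) (hf : f.support.Finite) :
    ∑' k, balancedStep ω f k / ω k = ∑' k, f k / ω k := by
  have h : ∀ k, balancedStep ω f k / ω k
      = f k / ω k + (f (k + 1) + f (k + -1) - 2 * f k) := by
    intro k
    have := (hω k).ne'
    rw [balancedStep, ← sub_eq_add_neg]
    field_simp
    ring
  have s₀ : Summable f := summable_of_hasFiniteSupport hf
  have s₁ : Summable fun k => f (k + 1) :=
    summable_of_hasFiniteSupport (finite_support_shift hf 1)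
  have s₂ : Summable fun k => f (k + -1) :=
    summable_of_hasFiniteSupport (finite_support_shift hf (-1))
  have s₃ : Summable fun k => f k / ω k :=
    summable_int_of_finite_support hf fun k hk => by simp [hk]
  rw [tsum_congr h, s₃.tsum_add ((s₁.add s₂).sub (s₀.mul_left 2)),
    (s₁.add s₂).tsum_sub (s₀.mul_left 2), s₁.tsum_add s₂, tsum_int_shift, tsum_int_shift,
    tsum_mul_left]
  ring

lemma summable_sq_int {f : ℤ → ℝ} (hf : f.support.Finite) : Summable fun k => f k ^ 2 :=
  summable_int_of_finite_support hf fun k hk => by simp [hk]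

lemma summable_sq_div_int {ω f : ℤ → ℝ} (hf : f.support.Finite) :
    Summable fun k => f k ^ 2 / ω k :=
  summable_int_of_finite_support hf fun k hk => by simp [hk]

lemma summable_sq_add_two_step {f : ℤ → ℝ} (hf : f.support.Finite) (t : ℝ) :
    Summable fun k => (f (k + 1) + t * f (k + -1)) ^ 2 := by
  refine summable_of_hasFiniteSupport
    (((finite_support_shift hf 1).union (finite_support_shift hf (-1))).subset ?_)
  intro k hk
  by_contra h
  simp only [Set.mem_union, Function.mem_support, not_or, not_not] at h
  exact hk (by simp [h.1, h.2])

lemma reversibleEnergy_nonneg {ω : ℤ → ℝ} (hω : ∀ k, 0 < ω k) (f : ℤ → ℝ) :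
    0 ≤ reversibleEnergy ω f :=
  tsum_nonneg fun k => div_nonneg (sq_nonneg _) (hω k).le

/-- The energy lost in one step controls the two-step Dirichlet form. -/
lemma reversibleEnergy_balancedStep_add_le {ω f : ℤ → ℝ} (hω : ∀ k, 0 < ω k ∧ ω k ≤ 1 / 2)
    (hf : f.support.Finite) :
    reversibleEnergy ω (balancedStep ω f) + 1 / 2 * ∑' k, (f (k + 1) + -1 * f (k + -1)) ^ 2
      ≤ reversibleEnergy ω f := by
  have h : ∀ k, balancedStep ω f k ^ 2 / ω k + 1 / 2 * (f (k + 1) + -1 * f (k + -1)) ^ 2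
      ≤ f k ^ 2 / ω k + (f (k + 1) ^ 2 + f (k + -1) ^ 2 - 2 * f k ^ 2) := by
    intro k
    have h0 := (hω k).1.ne'
    have e : balancedStep ω f k ^ 2 / ω k = f k ^ 2 / ω k
        + 2 * f k * (f (k + 1) + f (k + -1) - 2 * f k)
        + ω k * (f (k + 1) + f (k + -1) - 2 * f k) ^ 2 := by
      rw [balancedStep, ← sub_eq_add_neg]
      field_simp
      ring
    have := mul_le_mul_of_nonneg_right (hω k).2 (sq_nonneg (f (k + 1) + f (k + -1) - 2 * f k))
    rw [e]
    linarith
  have s₀ := summable_sq_int hf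
  have s₁ := summable_sq_int (finite_support_shift hf 1)
  have s₂ := summable_sq_int (finite_support_shift hf (-1))
  have s₃ : Summable fun k => f k ^ 2 / ω k := summable_sq_div_int hf
  have s₄ : Summable fun k => balancedStep ω f k ^ 2 / ω k :=
    summable_sq_div_int (finite_support_balancedStep hf)
  have s₅ := (summable_sq_add_two_step hf (-1)).mul_left (1 / 2)
  have s₆ := (s₁.add s₂).sub (s₀.mul_left 2)
  have key := (s₄.add s₅).tsum_le_tsum h (s₃.add s₆)
  rw [s₄.tsum_add s₅, s₃.tsum_add s₆, (s₁.add s₂).tsum_sub (s₀.mul_left 2), s₁.tsum_add s₂,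
    tsum_int_shift (fun k => f k ^ 2), tsum_int_shift (fun k => f k ^ 2), tsum_mul_left,
    tsum_mul_left] at key
  unfold reversibleEnergy
  linarith

/-- A discrete Gagliardo–Nirenberg inequality with two-step differences. -/
lemma pow_four_le_tsum_sq_mul_tsum_sq {f : ℤ → ℝ} (hf : f.support.Finite) (x : ℤ) :
    f x ^ 4 ≤ (∑' k, (f (k + 1) + -1 * f (k + -1)) ^ 2) * (4 * ∑' k, f k ^ 2) := by
  have hinj : Function.Injective fun n : ℕ => x + 2 * (n : ℤ) := by
    intro a b hab
    simpa using hab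
  have hinj' : Function.Injective fun n : ℕ => x + 2 * (n : ℤ) + 1 := by
    intro a b hab
    simpa using hab
  obtain ⟨N, hN⟩ : ∃ N : ℕ, f (x + 2 * (N : ℤ)) = 0 := by
    by_contra! h
    exact Set.infinite_of_injective_forall_mem hinj (s := f.support) h hf
  have htel : f x ^ 2 = ∑ n ∈ Finset.range N,
      (f (x + 2 * (n : ℤ) + 1 + 1) + -1 * f (x + 2 * (n : ℤ) + 1 + -1))
        * -(f (x + 2 * (n : ℤ) + 1 + 1) + 1 * f (x + 2 * (n : ℤ) + 1 + -1)) := by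
    have h := Finset.sum_range_sub' (fun n : ℕ => f (x + 2 * (n : ℤ)) ^ 2) N
    rw [hN] at h
    simp only [Nat.cast_zero, mul_zero, add_zero, ne_eq, OfNat.ofNat_ne_zero, not_false_eq_true,
      zero_pow, sub_zero] at h
    rw [← h]
    refine Finset.sum_congr rfl fun n _ => ?_
    rw [show x + 2 * (n : ℤ) + 1 + 1 = x + 2 * ((n + 1 : ℕ) : ℤ) by push_cast; ring,
      show x + 2 * (n : ℤ) + 1 + -1 = x + 2 * (n : ℤ) by ring]
    ring
  have hle : ∀ g : ℤ → ℝ, Summable g → (∀ k, 0 ≤ g k) →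
      ∑ n ∈ Finset.range N, g (x + 2 * (n : ℤ) + 1) ≤ ∑' k, g k := by
    intro g hg hg0
    have := hg.sum_le_tsum ((Finset.range N).map ⟨_, hinj'⟩) fun k _ => hg0 k
    simpa using this
  have h₁ := hle _ (summable_sq_add_two_step hf (-1)) fun k => sq_nonneg _
  have h₂ := hle _ (summable_sq_add_two_step hf 1) fun k => sq_nonneg _
  have s₁ := summable_sq_int (finite_support_shift hf 1)
  have s₂ := summable_sq_int (finite_support_shift hf (-1))
  have h₃ : ∑' k, (f (k + 1) + 1 * f (k + -1)) ^ 2 ≤ 4 * ∑' k, f k ^ 2 := by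
    have := (summable_sq_add_two_step hf 1).tsum_le_tsum
      (fun k => show _ ≤ 2 * (f (k + 1) ^ 2 + f (k + -1) ^ 2) by
        nlinarith [sq_nonneg (f (k + 1) - f (k + -1))]) ((s₁.add s₂).mul_left 2)
    rw [tsum_mul_left, s₁.tsum_add s₂, tsum_int_shift (fun k => f k ^ 2),
      tsum_int_shift (fun k => f k ^ 2)] at this
    linarith
  have h₄ := Finset.sum_mul_sq_le_sq_mul_sq (Finset.range N)
    (fun n : ℕ => f (x + 2 * (n : ℤ) + 1 + 1) + -1 * f (x + 2 * (n : ℤ) + 1 + -1))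
    (fun n : ℕ => -(f (x + 2 * (n : ℤ) + 1 + 1) + 1 * f (x + 2 * (n : ℤ) + 1 + -1)))
  rw [← htel, ← pow_mul] at h₄
  simp only [neg_sq] at h₄
  exact h₄.trans (mul_le_mul h₁ (h₂.trans h₃) (Finset.sum_nonneg fun _ _ => sq_nonneg _)
    (tsum_nonneg fun _ => sq_nonneg _))

lemma pow_four_le_energy_mul_energy_loss {ω f : ℤ → ℝ} (hω : ∀ k, 0 < ω k ∧ ω k ≤ 1 / 2)
    (hf : f.support.Finite) (x : ℤ) :
    f x ^ 4 ≤ 4 * reversibleEnergy ω f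
      * (reversibleEnergy ω f - reversibleEnergy ω (balancedStep ω f)) := by
  have h₁ := pow_four_le_tsum_sq_mul_tsum_sq hf x
  have h₂ := reversibleEnergy_balancedStep_add_le hω hf
  have h₃ : 2 * ∑' k, f k ^ 2 ≤ reversibleEnergy ω f := by
    rw [← tsum_mul_left]
    refine ((summable_sq_int hf).mul_left 2).tsum_le_tsum (fun k => ?_) (summable_sq_div_int hf)
    rw [le_div_iff₀ (hω k).1]
    nlinarith [sq_nonneg (f k), (hω k).2]
  have h₄ : 0 ≤ ∑' k, (f (k + 1) + -1 * f (k + -1)) ^ 2 := tsum_nonneg fun _ => sq_nonneg _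
  have h₅ : 0 ≤ ∑' k, f k ^ 2 := tsum_nonneg fun _ => sq_nonneg _
  nlinarith [mul_le_mul h₃ (show (∑' k, (f (k + 1) + -1 * f (k + -1)) ^ 2) ≤
    2 * (reversibleEnergy ω f - reversibleEnergy ω (balancedStep ω f)) by linarith) h₄
    (reversibleEnergy_nonneg (fun k => (hω k).1) f)]

/-- A Nash inequality for the energy loss. -/
lemma energy_cube_le_energy_loss {ω f : ℤ → ℝ} (hω : ∀ k, 0 < ω k ∧ ω k ≤ 1 / 2)
    (hf : f.support.Finite) (hf0 : ∀ k, 0 ≤ f k) {m : ℝ} (hm0 : 0 < m)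
    (hm : m * ∑' k, f k / ω k ≤ 1) :
    m ^ 4 / 4 * reversibleEnergy ω f ^ 3
      ≤ reversibleEnergy ω f - reversibleEnergy ω (balancedStep ω f) := by
  have hA := reversibleEnergy_nonneg (fun k => (hω k).1) f
  have hloss : 0 ≤ reversibleEnergy ω f - reversibleEnergy ω (balancedStep ω f) := by
    have h₁ := reversibleEnergy_balancedStep_add_le hω hf
    have h₂ : 0 ≤ ∑' k, (f (k + 1) + -1 * f (k + -1)) ^ 2 := tsum_nonneg fun _ => sq_nonneg _
    linarith
  rcases hA.eq_or_lt with h0 | hpos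
  · rw [← h0] at hloss ⊢
    simpa using hloss
  obtain ⟨x, hx⟩ : ∃ x, m * reversibleEnergy ω f ≤ f x := by
    obtain ⟨x, hxmax⟩ : ∃ x, ∀ k, f k ≤ f x := by
      obtain ⟨x, -, hx⟩ := Finset.exists_max_image (insert 0 hf.toFinset) f ⟨0, by simp⟩
      refine ⟨x, fun k => ?_⟩
      by_cases hk : f k = 0
      · exact hk ▸ hf0 x
      · exact hx k (by simp [hk])
    have hle : reversibleEnergy ω f ≤ ∑' k, f x * (f k / ω k) := by
      refine (summable_sq_div_int hf).tsum_le_tsum (fun k => ?_)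
        (summable_int_of_finite_support hf fun k hk => by simp [hk])
      rw [sq, mul_div_assoc]
      exact mul_le_mul_of_nonneg_right (hxmax k) (div_nonneg (hf0 k) (hω k).1.le)
    rw [tsum_mul_left] at hle
    refine ⟨x, ?_⟩
    nlinarith [mul_le_mul_of_nonneg_left hle hm0.le, mul_le_mul_of_nonneg_left hm (hf0 x)]
  have h₁ := pow_four_le_energy_mul_energy_loss hω hf x
  have h₂ := pow_le_pow_left₀ (mul_nonneg hm0.le hA) hx 4
  refine le_of_mul_le_mul_left ?_ (mul_pos four_pos hpos)
  calc _ = (m * reversibleEnergy ω f) ^ 4 := by ring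
    _ ≤ _ := h₂.trans h₁

lemma mul_sq_le_one_of_cube_le_sub {A : ℕ → ℝ} {κ : ℝ} (hκ : 0 < κ) (hA : ∀ n, 0 ≤ A n)
    (h : ∀ n, κ * A n ^ 3 ≤ A n - A (n + 1)) (n : ℕ) : κ * n * A n ^ 2 ≤ 1 := by
  induction n with
  | zero => simp
  | succ n ih =>
    have h₀ := hA n
    have h₁ := hA (n + 1)
    rcases h₀.eq_or_lt with h0 | hpos
    · have := h n
      rw [← h0] at this
      have : A (n + 1) = 0 := by linarith
      simp [this]
    have hb : A (n + 1) ≤ A n * (1 - κ * A n ^ 2) := by linarith [h n]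
    have hy : κ * A n ^ 2 ≤ 1 := by
      by_contra! hy
      nlinarith
    have hy0 : 0 ≤ κ * A n ^ 2 := by positivity
    have hb2 := pow_le_pow_left₀ h₁ hb 2
    push_cast
    calc κ * (n + 1) * A (n + 1) ^ 2
        ≤ κ * (n + 1) * (A n * (1 - κ * A n ^ 2)) ^ 2 := by gcongr
      _ = (κ * n * A n ^ 2 + κ * A n ^ 2) * (1 - κ * A n ^ 2) ^ 2 := by ring
      _ ≤ (1 + κ * A n ^ 2) * (1 - κ * A n ^ 2) ^ 2 := by gcongr
      _ = (1 - (κ * A n ^ 2) ^ 2) * (1 - κ * A n ^ 2) := by ring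
      _ ≤ 1 * 1 := by
        apply mul_le_mul <;> nlinarith
      _ = 1 := one_mul 1

lemma finite_support_Ppow (ω : ℤ → ℝ) (n : ℕ) (j : ℤ) :
    (fun k => Ppow ω n k j).support.Finite := by
  induction n with
  | zero =>
    refine (Set.finite_singleton j).subset fun k hk => ?_
    by_contra h
    exact hk (if_neg h)
  | succ n ih => exact finite_support_balancedStep ih

lemma Ppow_nonneg {ω : ℤ → ℝ} (hω : ∀ k, 0 < ω k ∧ ω k ≤ 1 / 2) (n : ℕ) (k j : ℤ) :
    0 ≤ Ppow ω n k j := by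
  induction n generalizing k with
  | zero =>
    simp only [Ppow]
    split_ifs <;> norm_num
  | succ n ih => exact balancedStep_nonneg hω ih k

lemma tsum_Ppow_div {ω : ℤ → ℝ} (hω : ∀ k, 0 < ω k) (n : ℕ) (j : ℤ) :
    ∑' k, Ppow ω n k j / ω k = 1 / ω j := by
  induction n with
  | zero =>
    rw [tsum_eq_single j fun k hk => by simp [Ppow, hk]]
    simp [Ppow]
  | succ n ih => exact (tsum_balancedStep_div hω (finite_support_Ppow ω n j)).trans ih

lemma exists_le_Ppow {ω : ℤ → ℝ} (hω : ∀ k, 0 < ω k ∧ ω k ≤ 1 / 2) {m n : ℕ} (hmn : m ≤ n)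
    (i j : ℤ) : ∃ k, Ppow ω n i j ≤ Ppow ω m k j := by
  induction n, hmn using Nat.le_induction generalizing i with
  | base => exact ⟨i, le_rfl⟩
  | succ n _ ih =>
    obtain ⟨k, hk⟩ := exists_le_of_le_balancedStep hω (f := fun k => Ppow ω n k j)
      (x := Ppow ω (n + 1) i j) (i := i) le_rfl
    obtain ⟨l, hl⟩ := ih k
    exact ⟨l, hk.trans hl⟩

lemma sqrt_mul_Ppow_le {ω : ℤ → ℝ} (hω : ∀ k, 0 < ω k ∧ ω k ≤ 1 / 2) {c : ℝ} (hc : 0 < c)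
    (hcω : ∀ k, c ≤ ω k) (n : ℕ) (i j : ℤ) : Real.sqrt n * Ppow ω n i j ≤ 4 / c := by
  set A : ℕ → ℝ := fun l => reversibleEnergy ω fun k => Ppow ω l k j
  have hA : ∀ l, 0 ≤ A l := fun l => reversibleEnergy_nonneg (fun k => (hω k).1) _
  have hcube : ∀ l, c ^ 4 / 4 * A l ^ 3 ≤ A l - A (l + 1) := fun l =>
    energy_cube_le_energy_loss hω (finite_support_Ppow ω l j) (fun k => Ppow_nonneg hω l k j) hc
      (by
        rw [tsum_Ppow_div (fun k => (hω k).1), mul_one_div, div_le_one (hω j).1]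
        exact hcω j)
  have hanti : Antitone A := antitone_nat_of_succ_le fun l => by
    have h₁ := hcube l
    have h₂ : 0 ≤ c ^ 4 / 4 * A l ^ 3 := mul_nonneg (by positivity) (pow_nonneg (hA l) 3)
    linarith
  set x := Ppow ω n i j
  have hx : 0 ≤ x := Ppow_nonneg hω n i j
  obtain ⟨N, hN⟩ : ∃ N, N = (n + 1) / 2 := ⟨_, rfl⟩
  have hterm : ∀ l ∈ Finset.Ico N (n + 1), x ^ 4 ≤ 4 * A N * (A l - A (l + 1)) := by
    intro l hl
    rw [Finset.mem_Ico] at hl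
    obtain ⟨k, hk⟩ := exists_le_Ppow hω (show l ≤ n by omega) i j
    have h₁ := pow_four_le_energy_mul_energy_loss hω (finite_support_Ppow ω l j) k
    have h₂ := pow_le_pow_left₀ hx hk 4
    have h₃ : A l ≤ A N := hanti hl.1
    have h₄ : 0 ≤ A l - A (l + 1) := sub_nonneg.2 (hanti l.le_succ)
    calc x ^ 4 ≤ 4 * A l * (A l - A (l + 1)) := h₂.trans h₁
      _ ≤ _ := by gcongr
  have hsum : ((n + 1 - N : ℕ) : ℝ) * x ^ 4 ≤ 4 * A N ^ 2 := by
    have h := Finset.card_nsmul_le_sum _ _ _ hterm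
    have hs := Finset.sum_Ico_sub A (show N ≤ n + 1 by omega)
    rw [← Finset.mul_sum, Nat.card_Ico, nsmul_eq_mul] at h
    have hs' : ∑ l ∈ Finset.Ico N (n + 1), (A l - A (l + 1)) = A N - A (n + 1) := by
      rw [← neg_sub (A (n + 1)), ← hs, ← Finset.sum_neg_distrib]
      simp
    rw [hs'] at h
    nlinarith [mul_nonneg (hA N) (hA (n + 1))]
  have hdecay := mul_sq_le_one_of_cube_le_sub (by positivity) hA hcube N
  have hN₁ : (n : ℝ) / 2 ≤ N := by
    have : n ≤ 2 * N := by omega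
    have : (n : ℝ) ≤ 2 * N := by exact_mod_cast this
    linarith
  have hN₂ : (n : ℝ) / 2 ≤ (n + 1 - N : ℕ) := by
    have : n ≤ 2 * (n + 1 - N) := by omega
    have : (n : ℝ) ≤ 2 * (n + 1 - N : ℕ) := by exact_mod_cast this
    linarith
  rw [le_div_iff₀ hc]
  refine le_of_pow_le_pow_left₀ four_ne_zero (by norm_num) ?_
  have hsq : Real.sqrt n ^ 4 = (n : ℝ) ^ 2 := by
    rw [show Real.sqrt n ^ 4 = (Real.sqrt n ^ 2) ^ 2 by ring, Real.sq_sqrt n.cast_nonneg]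
  calc (Real.sqrt n * x * c) ^ 4 = 4 * c ^ 4 * ((n : ℝ) / 2 * ((n : ℝ) / 2 * x ^ 4)) := by
        rw [mul_pow, mul_pow, hsq]; ring
    _ ≤ 4 * c ^ 4 * (N * (4 * A N ^ 2)) := by
        have h := (mul_le_mul_of_nonneg_right hN₂ (by positivity)).trans hsum
        exact mul_le_mul_of_nonneg_left (mul_le_mul hN₁ h (by positivity) (by positivity))
          (by positivity)
    _ = 64 * (c ^ 4 / 4 * N * A N ^ 2) := by ring
    _ ≤ 64 * 1 := by gcongr
    _ ≤ 4 ^ 4 := by norm_num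

/-- **Lemma 6 (heat-kernel bound, discrete time).**  If the environment is uniformly
elliptic, i.e. `inf_k ω_k > 0`, then there is `D > 0` with `(P^n)_{i,j} ≤ D n^{-1/2}`
for all `i, j ∈ ℤ` and `n ≥ 1`; in particular `sup_{n ≥ 0} sup_k √n (P^n)_{0,k} < ∞`. -/
theorem heat_kernel_bound_discrete
    (ω : ℤ → ℝ) (hω : ∀ k : ℤ, 0 < ω k ∧ ω k ≤ 1 / 2)
    (hell : ∃ c : ℝ, 0 < c ∧ ∀ k : ℤ, c ≤ ω k) :
    (∃ D : ℝ, 0 < D ∧ ∀ i j : ℤ, ∀ n : ℕ, 1 ≤ n → Ppow ω n i j ≤ D * (n : ℝ) ^ (-(1:ℝ)/2))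
    ∧ (∃ M : ℝ, ∀ n : ℕ, ∀ k : ℤ, Real.sqrt n * Ppow ω n 0 k ≤ M) := by
  obtain ⟨c, hc, hcω⟩ := hell
  refine ⟨⟨4 / c, by positivity, fun i j n hn => ?_⟩, 4 / c, fun n k =>
    sqrt_mul_Ppow_le hω hc hcω n 0 k⟩
  have hn' : (0 : ℝ) < n := by exact_mod_cast hn
  rw [neg_div, Real.rpow_neg hn'.le, ← Real.sqrt_eq_rpow, ← div_eq_mul_inv,
    le_div_iff₀ (Real.sqrt_pos.2 hn'), mul_comm]
  exact sqrt_mul_Ppow_le hω hc hcω n i j
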